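/- Let S' := MvPolynomial (Fin 3 × Fin 3) ℂ ⊗[ℂ] ExteriorAlgebra ℂ (Fin 3 × Fin 3 → ℂ), the free supercommutative ℂ-algebra on nine even generators u(i,t) (i ∈ {1,2,3}, t ∈ {0,1,2}) and nine odd generators e(q,t) (q ∈ {(1,2),(1,3),(2,3)}, t ∈ {0,1,2}). Define generic traceless 2×2 matrices over S': the even matrices Ψ_i := [[u(i,0), u(i,1)], [u(i,2), −u(i,0)]] for i = 1,2,3, and the odd matrices Ψ_{ij} := [[e((i,j),0), e((i,j),1)], [e((i,j),2), −e((i,j),0)]] for (i,j) ∈ {(1,2),(1,3),(2,3)}, with the convention Ψ_{ji} := −Ψ_{ij}. Define Ξ_f := Σ_τ Tr(Ψ_{τ(2)τ(3)}Ψ_{τ(1)} + Ψ_{τ(1)τ(3)}Ψ_{τ(2)})·Tr(Ψ_{τ(1)τ(2)}Ψ_{τ(1)})·Tr(Ψ_{τ(1)τ(3)}Ψ_{τ(2)τ(3)}Ψ_{τ(2)τ(3)}), where the sum runs over the three cyclic permutations τ of (1,2,3) and Tr is the 2×2 matrix trace. Then Ξ_f ≠ 0 in S'. -/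

import Mathlib

/-!
Statement 7: the superspace representative `Ξ_f^{sl₂}` of the first fortuitous
class for `sl₂`, viewed in the free supercommutative algebra on the matrix
entries (even entries polynomial variables, odd entries exterior generators),
is nonzero.
-/

open scoped TensorProduct

noncomputable section

/-- The free supercommutative ℂ-algebra `S'` on nine even generators `u(i,t)`
and nine odd generators `e(q,t)`. -/
abbrev SAlg' : Type :=
  MvPolynomial (Fin 3 × Fin 3) ℂ ⊗[ℂ] ExteriorAlgebra ℂ (Fin 3 × Fin 3 → ℂ)

/-- The even polynomial generator `u(i,t)`. -/
def uGen (i t : Fin 3) : SAlg' := MvPolynomial.X (i, t) ⊗ₜ[ℂ] 1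

/-- The odd exterior generator `e(q,t)`. -/
def eGen (q t : Fin 3) : SAlg' :=
  (1 : MvPolynomial (Fin 3 × Fin 3) ℂ) ⊗ₜ[ℂ]
    ExteriorAlgebra.ι ℂ (Pi.single (q, t) (1 : ℂ))

/-- The generic traceless even 2×2 matrices `Ψ_i`. -/
def PsiE (i : Fin 3) : Matrix (Fin 2) (Fin 2) SAlg' :=
  !![uGen i 0, uGen i 1; uGen i 2, -uGen i 0]

/-- The index of the pair `(i,j)` with `i < j` in the ordered list of pairs
`(0,1), (0,2), (1,2)` (one-based: `(1,2), (1,3), (2,3)`). -/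
def pairIdx (i j : Fin 3) : Fin 3 := ⟨min (i.val + j.val - 1) 2, by omega⟩

/-- The generic traceless odd 2×2 matrices `Ψ_{ij}`, antisymmetric in `i,j`
(with the convention `Ψ_{ji} = −Ψ_{ij}` and `Ψ_{ii} = 0`). -/
def PsiO (i j : Fin 3) : Matrix (Fin 2) (Fin 2) SAlg' :=
  if i < j then
    !![eGen (pairIdx i j) 0, eGen (pairIdx i j) 1;
       eGen (pairIdx i j) 2, -eGen (pairIdx i j) 0]
  else if j < i then
    -(!![eGen (pairIdx j i) 0, eGen (pairIdx j i) 1;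
         eGen (pairIdx j i) 2, -eGen (pairIdx j i) 0])
  else 0

/-- The contribution of the cyclic permutation sending `(1,2,3)` to `(a,b,c)`:
`Tr(Ψ_{bc}Ψ_a + Ψ_{ac}Ψ_b)·Tr(Ψ_{ab}Ψ_a)·Tr(Ψ_{ac}Ψ_{bc}Ψ_{bc})`. -/
def XiFterm (a b c : Fin 3) : SAlg' :=
  Matrix.trace (PsiO b c * PsiE a + PsiO a c * PsiE b) *
    Matrix.trace (PsiO a b * PsiE a) *
    Matrix.trace (PsiO a c * PsiO b c * PsiO b c)

/-- The fortuitous representative `Ξ_f`: the sum over the three cyclic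
permutations `(1,2,3), (2,3,1), (3,1,2)` (written 0-based). -/
def XiF : SAlg' := XiFterm 0 1 2 + XiFterm 1 2 0 + XiFterm 2 0 1

/-- The algebra map out of `S'` that evaluates the even generators at the scalars `v` and applies
the linear map `f` to the span of the odd generators. -/
def specialize {M : Type*} [AddCommGroup M] [Module ℂ M] (v : Fin 3 × Fin 3 → ℂ)
    (f : (Fin 3 × Fin 3 → ℂ) →ₗ[ℂ] M) : SAlg' →ₐ[ℂ] ExteriorAlgebra ℂ M :=
  Algebra.TensorProduct.lift ((Algebra.ofId ℂ _).comp (MvPolynomial.aeval v))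
    (ExteriorAlgebra.map f) fun p _ => Algebra.commute_algebraMap_left (MvPolynomial.aeval v p) _

theorem specialize_uGen {M : Type*} [AddCommGroup M] [Module ℂ M] (v : Fin 3 × Fin 3 → ℂ)
    (f : (Fin 3 × Fin 3 → ℂ) →ₗ[ℂ] M) (i t : Fin 3) :
    specialize v f (uGen i t) = algebraMap ℂ _ (v (i, t)) :=
  (Algebra.TensorProduct.lift_tmul _ _ _ _ _).trans (by simp [Algebra.ofId_apply])

theorem specialize_eGen {M : Type*} [AddCommGroup M] [Module ℂ M] (v : Fin 3 × Fin 3 → ℂ)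
    (f : (Fin 3 × Fin 3 → ℂ) →ₗ[ℂ] M) (q t : Fin 3) :
    specialize v f (eGen q t) = ExteriorAlgebra.ι ℂ (f (Pi.single (q, t) 1)) :=
  (Algebra.TensorProduct.lift_tmul _ _ _ _ _).trans (by simp)

/-- The odd generators that survive the specialization used to detect `Ξ_f`. -/
def survivingIdx : Fin 5 → Fin 3 × Fin 3 := ![(2, 2), (0, 2), (1, 2), (2, 0), (2, 1)]

/-- Evaluating `Ψ₁` at the nilpotent matrix unit and `Ψ₂`, `Ψ₃` at zero leaves a single summand of
`Ξ_f`. -/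
theorem specialize_XiF :
    specialize (Pi.single (0, 1) 1) (LinearMap.funLeft ℂ ℂ survivingIdx) XiF =
      ExteriorAlgebra.ιMulti ℂ 5 (fun k => (Pi.single k 1 : Fin 5 → ℂ)) -
      ExteriorAlgebra.ιMulti ℂ 5 (fun k => (Pi.single (Equiv.swap 3 4 k) 1 : Fin 5 → ℂ)) := by
  have hs (p : Fin 3 × Fin 3) (j : Fin 5) (h : ∀ k, survivingIdx k = p ↔ k = j) :
      LinearMap.funLeft ℂ ℂ survivingIdx (Pi.single p 1) = Pi.single j 1 := by
    ext k
    simp [LinearMap.funLeft_apply, h, Pi.single_apply]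
  have hz (p : Fin 3 × Fin 3) (h : ∀ k, survivingIdx k ≠ p) :
      LinearMap.funLeft ℂ ℂ survivingIdx (Pi.single p 1) = 0 := by
    ext k
    simp [LinearMap.funLeft_apply, h]
  have hprod (σ : Fin 5 → Fin 5) :
      ExteriorAlgebra.ιMulti ℂ 5 (fun k => (Pi.single (σ k) 1 : Fin 5 → ℂ)) =
        ExteriorAlgebra.ι ℂ (Pi.single (σ 0) 1) * (ExteriorAlgebra.ι ℂ (Pi.single (σ 1) 1) *
          (ExteriorAlgebra.ι ℂ (Pi.single (σ 2) 1) * (ExteriorAlgebra.ι ℂ (Pi.single (σ 3) 1) *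
            ExteriorAlgebra.ι ℂ (Pi.single (σ 4) 1)))) := by
    simp only [ExteriorAlgebra.ιMulti_apply, List.ofFn_succ, List.ofFn_zero, List.prod_cons,
      List.prod_nil, mul_one]
    rfl
  have hswap : ⇑(Equiv.swap (3 : Fin 5) 4) = ![0, 1, 2, 4, 3] := by decide
  rw [hswap, hprod, hprod]
  simp only [XiF, XiFterm, PsiO, PsiE, pairIdx, Matrix.trace_fin_two, Matrix.add_apply,
    Matrix.mul_apply, Fin.sum_univ_two]
  simp [specialize_uGen, specialize_eGen, hs (2, 2) 0 (by decide), hs (0, 2) 1 (by decide),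
    hs (1, 2) 2 (by decide), hs (2, 0) 3 (by decide), hs (2, 1) 4 (by decide),
    hz (0, 0) (by decide), hz (0, 1) (by decide), hz (1, 0) (by decide), hz (1, 1) (by decide)]
  noncomm_ring

/-- The explicit fortuitous representative `Ξ_f^{sl₂}` is a
nonzero element of the free supercommutative algebra `S'`. -/
theorem xiF_ne_zero : XiF ≠ 0 := by
  intro h
  have key := congrArg (ExteriorAlgebra.liftAlternating (R := ℂ)
    (Pi.single 5 (Matrix.detRowAlternating : (Fin 5 → ℂ) [⋀^Fin 5]→ₗ[ℂ] ℂ))) specialize_XiF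
  rw [h, map_zero, map_zero, map_sub, ExteriorAlgebra.liftAlternating_apply_ιMulti,
    ExteriorAlgebra.liftAlternating_apply_ιMulti, Pi.single_eq_same] at key
  have hswap := AlternatingMap.map_swap
    (Matrix.detRowAlternating : (Fin 5 → ℂ) [⋀^Fin 5]→ₗ[ℂ] ℂ)
    (fun k => (Pi.single k 1 : Fin 5 → ℂ)) (show (3 : Fin 5) ≠ 4 by decide)
  have hone : (Matrix.detRowAlternating : (Fin 5 → ℂ) [⋀^Fin 5]→ₗ[ℂ] ℂ)
      (fun k => (Pi.single k 1 : Fin 5 → ℂ)) = 1 := by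
    rw [← Matrix.det_one (n := Fin 5) (R := ℂ)]
    congr 1
    ext i j
    simp [Matrix.one_apply, Pi.single_apply, eq_comm]
  rw [Function.comp_def, hone] at hswap
  rw [hone, hswap] at key
  norm_num at key
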